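/- Let (Q,n) be a regular local ring of dimension three, and let f₁, f₂ ∈ n² be a Q-regular sequence with f₁ ∈ n² \ n³. Set A = Q/(f₁,f₂), a one-dimensional Cohen–Macaulay local ring. If M is a maximal Cohen–Macaulay A-module, then the Hilbert function of M with respect to the maximal ideal of A is non-decreasing: H(M,n) ≤ H(M,n+1) for all n ≥ 0. -/

import Mathlib

open IsLocalRing

/-- The length of a module, i.e. the Krull dimension of its lattice of submodules. -/
noncomputable def moduleLength (R : Type*) (M : Type*) [CommRing R] [AddCommGroup M]
    [Module R M] : WithBot ℕ∞ :=
  Order.krullDim (Submodule R M)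

/-- The Hilbert function of a module `M` with respect to an ideal `I`:
`n ↦ length (I^n M / I^(n+1) M)`. -/
noncomputable def hilbertFn (R : Type*) (M : Type*) [CommRing R] [AddCommGroup M]
    [Module R M] (I : Ideal R) (n : ℕ) : WithBot ℕ∞ :=
  moduleLength R (↥(I ^ n • (⊤ : Submodule R M)) ⧸
    (Submodule.comap (I ^ n • (⊤ : Submodule R M)).subtype (I ^ (n + 1) • (⊤ : Submodule R M))))

/-- The depth of `M` with respect to the ideal `I`: the supremum of lengths of
`M`-regular sequences consisting of elements of `I`. -/
noncomputable def seqDepth (R : Type*) (M : Type*) [CommRing R] [AddCommGroup M]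
    [Module R M] (I : Ideal R) : ℕ∞ :=
  sSup {n : ℕ∞ | ∃ rs : List R, (rs.length : ℕ∞) = n ∧ (∀ x ∈ rs, x ∈ I) ∧
    RingTheory.Sequence.IsRegular M rs}

lemma exists_add_pow_notMem {R : Type*} [CommRing R] [IsLocalRing R] {r : R}
    (hr : r ∈ maximalIdeal R) {S : Set (Ideal R)} (hS : S.Finite) (hprime : ∀ P ∈ S, P.IsPrime)
    (hrS : ∀ P ∈ S, r ∉ P) (x : R) : ∃ j, 2 ≤ j ∧ ∀ P ∈ S, x + r ^ j ∉ P := by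
  by_contra! h
  choose! P hPS hP using h
  have : Finite S := hS
  obtain ⟨i, j, hij, heq⟩ := Finite.exists_ne_map_eq_of_infinite
    (fun n : ℕ => (⟨P (n + 2), hPS _ (by omega)⟩ : S))
  wlog hlt : i < j generalizing i j
  · exact this j i hij.symm heq.symm (by omega)
  simp only [Subtype.mk.injEq] at heq
  have hi := hP (i + 2) (by omega)
  have hj := hP (j + 2) (by omega)
  rw [← heq] at hj
  have := hprime _ (hPS (i + 2) (by omega))
  have hsub := sub_mem hi hj
  have hu : IsUnit (1 - r ^ (j - i)) := by
    by_contra hu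
    have h1 : (1 : R) ∈ maximalIdeal R := by
      have := add_mem ((mem_maximalIdeal _).2 hu)
        (Ideal.pow_mem_of_mem _ hr (j - i) (by omega))
      rwa [sub_add_cancel] at this
    exact (Ideal.ne_top_iff_one _).1 Ideal.IsPrime.ne_top' h1
  have he : x + r ^ (i + 2) - (x + r ^ (j + 2)) = r ^ (i + 2) * (1 - r ^ (j - i)) := by
    rw [mul_sub, ← pow_add, show i + 2 + (j - i) = j + 2 by omega]; ring
  rw [he] at hsub
  rcases this.mem_or_mem hsub with h | h
  · exact hrS _ (hPS _ (by omega)) (this.mem_of_pow_mem _ h)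
  · exact this.ne_top (Ideal.eq_top_of_isUnit_mem _ h hu)

lemma ENat.le_of_add_eq_add {a b c v w k l m : ℕ∞} (hc : c ≠ ⊤) (hk : k ≠ ⊤) (hl : l ≠ ⊤)
    (hm : m ≠ ⊤) (hwv : w ≤ v) (h₁ : k + c = v + l) (h₂ : l + c = w + m) (h₃ : l = a + k)
    (h₄ : m = b + l) : a ≤ b := by
  lift c to ℕ using hc
  lift k to ℕ using hk
  lift l to ℕ using hl
  lift m to ℕ using hm
  induction a <;> induction b <;> induction v <;> induction w <;> simp_all
  norm_cast at *
  omega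

section Length

variable {A M : Type*} [CommRing A] [AddCommGroup M] [Module A M]

lemma Module.length_quotient_eq_add_of_le {B C : Submodule A M} (h : C ≤ B) :
    Module.length A (M ⧸ C) =
      Module.length A (B ⧸ C.comap B.subtype) + Module.length A (M ⧸ B) := by
  refine Module.length_eq_add_of_exact (Submodule.mapQ _ C B.subtype le_rfl)
    (Submodule.factor h) ?_ (Submodule.factor_surjective h) ?_
  · rw [← LinearMap.ker_eq_bot, Submodule.mapQ, Submodule.ker_liftQ, LinearMap.ker_comp,
      Submodule.ker_mkQ]
    exact Submodule.mkQ_map_self _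
  · rw [LinearMap.exact_iff]
    simp only [Submodule.factor, Submodule.mapQ, Submodule.ker_liftQ, Submodule.range_liftQ,
      LinearMap.range_comp, Submodule.range_subtype, LinearMap.ker_comp, Submodule.ker_mkQ]
    simp

open Pointwise in
lemma Module.length_quotient_smul_of_isSMulRegular {x : A} (hx : IsSMulRegular M x)
    (N : Submodule A M) : Module.length A (M ⧸ x • N) =
      Module.length A (M ⧸ N) + Module.length A (M ⧸ x • (⊤ : Submodule A M)) := by
  have hle : x • N ≤ x • (⊤ : Submodule A M) := smul_mono_right x le_top
  have hcomap : N ≤ (x • N).comap (LinearMap.lsmul A M x) := fun n hn =>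
    Submodule.smul_mem_pointwise_smul n x N hn
  refine Module.length_eq_add_of_exact (Submodule.mapQ N (x • N) (LinearMap.lsmul A M x) hcomap)
    (Submodule.factor hle) ?_ (Submodule.factor_surjective hle) ?_
  · rw [← LinearMap.ker_eq_bot, Submodule.mapQ, Submodule.ker_liftQ, LinearMap.ker_comp,
      Submodule.ker_mkQ, eq_bot_iff, Submodule.map_le_iff_le_comap]
    intro m hm
    obtain ⟨n, hn, hnm⟩ := (Submodule.mem_smul_pointwise_iff_exists _ _ _).1 hm
    have : n = m := hx hnm
    subst this
    simpa using hn
  · intro z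
    obtain ⟨z, rfl⟩ := Submodule.mkQ_surjective _ z
    simp only [Submodule.factor, Submodule.mapQ_apply, Submodule.mkQ_apply, LinearMap.id_apply,
      Submodule.Quotient.mk_eq_zero]
    rw [Submodule.mem_smul_pointwise_iff_exists]
    constructor
    · rintro ⟨b, -, rfl⟩
      exact ⟨Submodule.Quotient.mk b, rfl⟩
    · rintro ⟨b, hb⟩
      obtain ⟨b, rfl⟩ := Submodule.mkQ_surjective _ b
      rw [Submodule.mkQ_apply, Submodule.mapQ_apply, LinearMap.lsmul_apply,
        Submodule.Quotient.eq, Submodule.mem_smul_pointwise_iff_exists] at hb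
      obtain ⟨n, -, hn⟩ := hb
      exact ⟨b - n, trivial, by rw [smul_sub, hn]; abel⟩

open Pointwise in
lemma Module.length_quotient_comap_subtype_le_of_le_sup_smul {y : A} {B B' C C' : Submodule A M}
    (hB : y • B ≤ B') (hC : y • C ≤ C') (hB' : B' ≤ C' ⊔ y • B) :
    Module.length A (B' ⧸ C'.comap B'.subtype) ≤ Module.length A (B ⧸ C.comap B.subtype) := by
  let g : B →ₗ[A] B' := (LinearMap.lsmul A M y).restrict
    fun m hm => hB (Submodule.smul_mem_pointwise_smul m y B hm)
  have hg : C.comap B.subtype ≤ (C'.comap B'.subtype).comap g := fun m hm =>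
    hC (Submodule.smul_mem_pointwise_smul _ y C hm)
  refine Module.length_le_of_surjective (Submodule.mapQ _ _ g hg) fun z => ?_
  obtain ⟨⟨z, hz⟩, rfl⟩ := Submodule.mkQ_surjective _ z
  obtain ⟨c, hc, w, hw, hcw⟩ := Submodule.mem_sup.1 (hB' hz)
  obtain ⟨b, hb, rfl⟩ := (Submodule.mem_smul_pointwise_iff_exists _ _ _).1 hw
  refine ⟨Submodule.Quotient.mk ⟨b, hb⟩, ?_⟩
  rw [Submodule.mapQ_apply, Submodule.mkQ_apply, Submodule.Quotient.eq]
  have : y • b - z = -c := by rw [← hcw]; abel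
  change y • b - z ∈ C'
  rw [this]
  exact neg_mem hc

open Pointwise in
lemma Module.length_quotient_pow_smul_ne_top {x : A} (hx : IsSMulRegular M x)
    (hfin : Module.length A (M ⧸ x • (⊤ : Submodule A M)) ≠ ⊤) (n : ℕ) :
    Module.length A (M ⧸ x ^ n • (⊤ : Submodule A M)) ≠ ⊤ := by
  induction n with
  | zero => simp
  | succ n ih =>
    rw [pow_succ', mul_smul, Module.length_quotient_smul_of_isSMulRegular hx]
    exact by simp [ih, hfin]

open Pointwise in
/-- If `I ^ 2 = (x, y) I` with `x` regular on `M` and `M / x M` of finite length, then the Hilbert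
function of `M` with respect to `I` is non-decreasing. -/
lemma Module.length_pow_smul_quotient_le_succ {I : Ideal A} {x y : A} (hxI : x ∈ I) (hyI : y ∈ I)
    (hI : I ^ 2 ≤ Ideal.span {x, y} * I) (hx : IsSMulRegular M x)
    (hfin : Module.length A (M ⧸ x • (⊤ : Submodule A M)) ≠ ⊤) (n : ℕ) :
    Module.length A (↥(I ^ n • (⊤ : Submodule A M)) ⧸
      (I ^ (n + 1) • (⊤ : Submodule A M)).comap (I ^ n • (⊤ : Submodule A M)).subtype) ≤
    Module.length A (↥(I ^ (n + 1) • (⊤ : Submodule A M)) ⧸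
      (I ^ (n + 2) • (⊤ : Submodule A M)).comap (I ^ (n + 1) • (⊤ : Submodule A M)).subtype) := by
  have hsmul : ∀ z ∈ I, ∀ k, z • (I ^ k • (⊤ : Submodule A M)) ≤ I ^ (k + 1) • ⊤ := by
    intro z hz k
    rw [pow_succ', Submodule.mul_smul]
    rintro _ ⟨m, hm, rfl⟩
    exact Submodule.smul_mem_smul hz hm
  have hanti : ∀ k, I ^ (k + 1) • (⊤ : Submodule A M) ≤ I ^ k • ⊤ := fun k =>
    Submodule.smul_mono_left (Ideal.pow_le_pow_right k.le_succ)
  have hL : ∀ k, Module.length A (M ⧸ I ^ k • (⊤ : Submodule A M)) ≠ ⊤ := by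
    intro k
    have hle : x ^ k • (⊤ : Submodule A M) ≤ I ^ k • ⊤ := by
      rintro _ ⟨m, hm, rfl⟩
      exact Submodule.smul_mem_smul (Ideal.pow_mem_pow hxI k) hm
    exact ne_top_of_le_ne_top (Module.length_quotient_pow_smul_ne_top hx hfin k)
      (Module.length_le_of_surjective _ (Submodule.factor_surjective hle))
  have hdecomp : I ^ (n + 2) • (⊤ : Submodule A M) ≤
      x • (I ^ (n + 1) • (⊤ : Submodule A M)) ⊔ y • (I ^ (n + 1) • (⊤ : Submodule A M)) := by
    have h1 : I ^ (n + 2) ≤ Ideal.span {x, y} * I ^ (n + 1) :=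
      calc I ^ (n + 2) = I ^ 2 * I ^ n := by ring
        _ ≤ Ideal.span {x, y} * I * I ^ n := Ideal.mul_mono_left hI
        _ = Ideal.span {x, y} * I ^ (n + 1) := by ring
    refine (Submodule.smul_mono_left h1).trans ?_
    rw [Submodule.mul_smul, Ideal.span_insert, Submodule.sup_smul,
      Submodule.ideal_span_singleton_smul, Submodule.ideal_span_singleton_smul]
  have hle := Module.length_quotient_comap_subtype_le_of_le_sup_smul (y := y)
    (B := I ^ (n + 1) • (⊤ : Submodule A M)) (B' := I ^ (n + 2) • (⊤ : Submodule A M))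
    (C := x • (I ^ n • (⊤ : Submodule A M))) (C' := x • (I ^ (n + 1) • (⊤ : Submodule A M)))
    (hsmul y hyI _) (by
      rw [← mul_smul, mul_comm, mul_smul]
      exact smul_mono_right x (hsmul y hyI n)) hdecomp
  have e1 := Module.length_quotient_eq_add_of_le (hsmul x hxI n)
  have e2 := Module.length_quotient_eq_add_of_le (hsmul x hxI (n + 1))
  have e3 := Module.length_quotient_eq_add_of_le (hanti n)
  have e4 := Module.length_quotient_eq_add_of_le (hanti (n + 1))
  rw [Module.length_quotient_smul_of_isSMulRegular hx] at e1 e2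
  exact ENat.le_of_add_eq_add hfin (hL n) (hL (n + 1)) (hL (n + 2)) hle e1 e2 e3 e4

end Length

lemma map_maximalIdeal_of_surjective {R S : Type*} [CommRing R] [CommRing S] [IsLocalRing R]
    [IsLocalRing S] {f : R →+* S} (hf : Function.Surjective f) :
    (maximalIdeal R).map f = maximalIdeal S := by
  rw [← eq_maximalIdeal (Ideal.comap_isMaximal_of_surjective f hf (K := maximalIdeal S)),
    Ideal.map_comap_of_surjective f hf]

lemma exists_mem_maximalIdeal_notMem_minimalPrimes {R : Type*} [CommRing R] [IsNoetherianRing R]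
    [IsLocalRing R] (hdim : 1 ≤ ringKrullDim R) :
    ∃ r ∈ maximalIdeal R, ∀ P ∈ minimalPrimes R, r ∉ P := by
  by_contra! h
  have hsub : ((maximalIdeal R : Ideal R) : Set R) ⊆ ⋃ P ∈ minimalPrimes R, (P : Set R) := by
    intro r hr
    obtain ⟨P, hP, hrP⟩ := h r hr
    exact Set.mem_biUnion hP hrP
  obtain ⟨P, hP⟩ := Ideal.nonempty_minimalPrimes (bot_ne_top (α := Ideal R))
  have hprime : ∀ P ∈ minimalPrimes R, P.IsPrime := fun P hP => hP.1.1
  rw [Ideal.subset_iUnion_iff_mem_of_isMaximal_of_finite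
    (minimalPrimes.finite_of_isNoetherianRing R) P P (fun I hI _ _ => hprime I hI)
    (hprime P hP).ne_top (hprime P hP).ne_top] at hsub
  rw [← maximalIdeal_height_eq_ringKrullDim,
    Ideal.height_eq_zero_iff.2 hsub] at hdim
  exact absurd hdim (by decide)

lemma isDomain_of_isPrime_span_singleton {R : Type*} [CommRing R] [IsNoetherianRing R]
    [IsLocalRing R] {x : R} (hx : x ∈ maximalIdeal R) (hmin : ∀ P ∈ minimalPrimes R, x ∉ P)
    (hprime : (Ideal.span {x}).IsPrime) : IsDomain R := by
  obtain ⟨p, hp, hpx⟩ := Ideal.exists_minimalPrimes_le (I := (⊥ : Ideal R)) (J := Ideal.span {x})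
    bot_le
  have hpp : p.IsPrime := hp.1.1
  have hbot : p = ⊥ := by
    refine Submodule.eq_bot_of_le_smul_of_le_jacobson_bot (maximalIdeal R) p
      (IsNoetherian.noetherian _) ?_ (maximalIdeal_le_jacobson _)
    intro a ha
    obtain ⟨c, rfl⟩ := Ideal.mem_span_singleton'.1 (hpx ha)
    rw [mul_comm]
    exact Submodule.smul_mem_smul hx ((hpp.mem_or_mem ha).resolve_right (hmin p hp))
  rw [hbot] at hpp
  exact IsDomain.of_bot_isPrime R

open RingTheory.Sequence in
/-- A Noetherian local ring whose maximal ideal is generated by at most as many elements as its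
dimension is a domain and has a regular sequence of that length. -/
lemma isDomain_and_exists_isWeaklyRegular (n : ℕ) (R : Type*) [CommRing R] [IsNoetherianRing R]
    [IsLocalRing R] (hdim : n ≤ ringKrullDim R) (x : Fin n → R)
    (hx : maximalIdeal R = Ideal.span (Set.range x)) :
    IsDomain R ∧ ∃ rs : List R, rs.length = n ∧ (∀ r ∈ rs, r ∈ maximalIdeal R) ∧
      IsWeaklyRegular R rs := by
  induction n generalizing R with
  | zero =>
    rw [Set.range_eq_empty, Ideal.span_empty] at hx
    have hb := (maximalIdeal.isMaximal R).isPrime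
    rw [hx] at hb
    exact ⟨IsDomain.of_bot_isPrime R, [], rfl, by simp, .nil R R⟩
  | succ n ih =>
    have hdim1 : 1 ≤ ringKrullDim R := le_trans (by norm_cast; omega) hdim
    obtain ⟨r, hrm, hr⟩ := exists_mem_maximalIdeal_notMem_minimalPrimes hdim1
    obtain ⟨j, hj, hxj⟩ := exists_add_pow_notMem hrm
      (minimalPrimes.finite_of_isNoetherianRing R) (fun P hP => hP.1.1) hr (x 0)
    set y := x 0 + r ^ j with hy
    have hxm (i) : x i ∈ maximalIdeal R := hx ▸ Ideal.subset_span ⟨i, rfl⟩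
    have hrj : r ^ j ∈ maximalIdeal R ^ 2 :=
      Ideal.pow_le_pow_right hj (Ideal.pow_mem_pow hrm j)
    have hym : y ∈ maximalIdeal R :=
      add_mem (hxm 0) (Ideal.pow_le_self two_ne_zero hrj)
    have hgen : maximalIdeal R ≤ Ideal.span {y} ⊔ Ideal.span (Set.range (Fin.tail x)) := by
      refine Submodule.le_of_le_smul_of_le_jacobson_bot (I := maximalIdeal R)
        (IsNoetherian.noetherian _) (maximalIdeal_le_jacobson _) ?_
      conv_lhs => rw [hx]
      rw [Ideal.span_le]
      rintro _ ⟨i, rfl⟩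
      refine Fin.cases ?_ (fun i => ?_) i
      · rw [← add_sub_cancel_right (x 0) (r ^ j), ← hy]
        refine sub_mem (Ideal.mem_sup_left (Ideal.mem_sup_left (Ideal.mem_span_singleton_self y)))
          (Ideal.mem_sup_right ?_)
        rwa [smul_eq_mul, ← pow_two]
      · exact Ideal.mem_sup_left (Ideal.mem_sup_right (Ideal.subset_span ⟨i, rfl⟩))
    have hne : Ideal.span {y} ≠ ⊤ := by
      rwa [Ne, Ideal.span_singleton_eq_top]
    have : Nontrivial (R ⧸ Ideal.span {y}) := Ideal.Quotient.nontrivial_iff.2 hne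
    have hsurj : Function.Surjective (Ideal.Quotient.mk (Ideal.span {y})) :=
      Ideal.Quotient.mk_surjective
    have : IsLocalRing (R ⧸ Ideal.span {y}) := .of_surjective' _ hsurj
    have hmap := map_maximalIdeal_of_surjective hsurj
    obtain ⟨hdom, rs', hlen, hmem, hreg⟩ := ih (R ⧸ Ideal.span {y}) (by
      have := ringKrullDim_le_ringKrullDim_quotient_add_encard {y}
        (by simpa [ringJacobson_eq_maximalIdeal] using hym)
      have h := hdim.trans this
      rw [Set.encard_singleton] at h
      generalize ringKrullDim (R ⧸ Ideal.span {y}) = d at h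
      induction d with
      | bot => exact absurd h (by simp)
      | coe d =>
        induction d with
        | top => simp
        | coe d => norm_cast at h ⊢; omega) (fun i => Ideal.Quotient.mk _ (Fin.tail x i)) (by
        apply le_antisymm
        · rw [← hmap, Ideal.map_le_iff_le_comap]
          refine hgen.trans (sup_le ?_ ?_) <;> rw [Ideal.span_le]
          · rintro _ rfl
            simp
          · rintro _ ⟨i, rfl⟩
            exact Ideal.subset_span ⟨i, rfl⟩
        · rw [Ideal.span_le]
          rintro _ ⟨i, rfl⟩
          rw [← hmap]
          exact Ideal.mem_map_of_mem _ (hxm _))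
    have hR := isDomain_of_isPrime_span_singleton hym hxj
      ((Ideal.Quotient.isDomain_iff_prime _).1 hdom)
    have hy0 : y ≠ 0 := by
      rintro h0
      obtain ⟨P, hP⟩ := Ideal.nonempty_minimalPrimes (bot_ne_top (α := Ideal R))
      exact hxj P hP (h0 ▸ P.zero_mem)
    obtain ⟨rs, rfl⟩ := List.map_surjective_iff.2 hsurj rs'
    refine ⟨hR, y :: rs, by simpa using hlen, ?_, ?_⟩
    · simp only [List.mem_cons, forall_eq_or_imp]
      refine ⟨hym, fun r hr => ?_⟩
      have := hmem _ (List.mem_map_of_mem hr)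
      by_contra hr'
      rw [mem_maximalIdeal, mem_nonunits_iff, not_not] at hr'
      exact (mem_maximalIdeal _).1 this (hr'.map _)
    · rw [isWeaklyRegular_cons_iff]
      refine ⟨IsSMulRegular.of_ne_zero hy0, ?_⟩
      rw [← Ideal.Quotient.algebraMap_eq, isWeaklyRegular_map_algebraMap_iff] at hreg
      refine (LinearEquiv.isWeaklyRegular_congr (Submodule.quotEquivOfEq _ _ ?_) rs).1 hreg
      rw [← Submodule.ideal_span_singleton_smul, smul_eq_mul, Ideal.mul_top]

section Quadric

variable {R : Type*} [CommRing R]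

lemma Ideal.sq_span_le_of_isUnit {x y z f p q r s t w : R} {m : Ideal R}
    (hm : m = Ideal.span {x, y, z})
    (hf : f = p * x ^ 2 + q * y ^ 2 + r * z ^ 2 + s * (x * y) + t * (x * z) + w * (y * z))
    (hr : IsUnit r) : m ^ 2 ≤ Ideal.span {f} ⊔ Ideal.span {x, y} * m := by
  have hxm : x ∈ m := hm ▸ Ideal.subset_span (by simp)
  have hym : y ∈ m := hm ▸ Ideal.subset_span (by simp)
  have hzm : z ∈ m := hm ▸ Ideal.subset_span (by simp)
  have hx : x ∈ Ideal.span {x, y} := Ideal.subset_span (by simp)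
  have hy : y ∈ Ideal.span {x, y} := Ideal.subset_span (by simp)
  set J := Ideal.span {f} ⊔ Ideal.span {x, y} * m with hJ
  have hJx : ∀ g ∈ m, x * g ∈ J := fun g hg => Ideal.mem_sup_right (Ideal.mul_mem_mul hx hg)
  have hJy : ∀ g ∈ m, y * g ∈ J := fun g hg => Ideal.mem_sup_right (Ideal.mul_mem_mul hy hg)
  have hfJ : f ∈ J := Ideal.mem_sup_left (Ideal.mem_span_singleton_self f)
  have hzz : z * z ∈ J := by
    rw [← Ideal.unit_mul_mem_iff_mem J hr]
    have : r * (z * z) = f - (p * (x * x) + q * (y * y) + s * (x * y) + t * (x * z)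
        + w * (y * z)) := by rw [hf]; ring
    rw [this]
    refine sub_mem hfJ (add_mem (add_mem (add_mem (add_mem ?_ ?_) ?_) ?_) ?_) <;>
      apply Ideal.mul_mem_left
    exacts [hJx _ hxm, hJy _ hym, hJx _ hym, hJx _ hzm, hJy _ hzm]
  have hz : ∀ g ∈ m, z * g ∈ J := by
    intro g hg
    rw [hm] at hg
    obtain ⟨a, b, c, rfl⟩ := Submodule.mem_span_triple.1 hg
    have : z * (a • x + b • y + c • z) = a * (x * z) + b * (y * z) + c * (z * z) := by
      simp only [smul_eq_mul]; ring
    rw [this]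
    exact add_mem (add_mem (Ideal.mul_mem_left _ _ (hJx _ hzm))
      (Ideal.mul_mem_left _ _ (hJy _ hzm))) (Ideal.mul_mem_left _ _ hzz)
  rw [pow_two, Ideal.mul_le]
  intro g hg h hh
  rw [hm] at hg
  obtain ⟨a, b, c, rfl⟩ := Submodule.mem_span_triple.1 hg
  have : (a • x + b • y + c • z) * h = a * (x * h) + b * (y * h) + c * (z * h) := by
    simp only [smul_eq_mul]; ring
  rw [this]
  exact add_mem (add_mem (Ideal.mul_mem_left _ _ (hJx _ hh))
    (Ideal.mul_mem_left _ _ (hJy _ hh))) (Ideal.mul_mem_left _ _ (hz _ hh))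

variable [IsLocalRing R]

lemma exists_sq_maximalIdeal_le_of_isUnit_mixed {x y z f p q r s t w : R}
    (hm : maximalIdeal R = Ideal.span {x, y, z})
    (hf : f = p * x ^ 2 + q * y ^ 2 + r * z ^ 2 + s * (x * y) + t * (x * z) + w * (y * z))
    (hp : p ∈ maximalIdeal R) (hq : q ∈ maximalIdeal R) (hs : IsUnit s) :
    ∃ a ∈ maximalIdeal R, ∃ b ∈ maximalIdeal R,
      maximalIdeal R ^ 2 ≤ Ideal.span {f} ⊔ Ideal.span {a, b} * maximalIdeal R := by
  have hm' : maximalIdeal R = Ideal.span {x - y, z, y} := by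
    rw [hm]
    apply le_antisymm <;> rw [Ideal.span_le] <;> rintro g (rfl | rfl | rfl)
    · exact Submodule.mem_span_triple.2 ⟨1, 0, 1, by simp⟩
    · exact Ideal.subset_span (by simp)
    · exact Ideal.subset_span (by simp)
    · exact Submodule.mem_span_triple.2 ⟨1, -1, 0, by simp; ring⟩
    · exact Ideal.subset_span (by simp)
    · exact Ideal.subset_span (by simp)
  have hu : IsUnit (p + q + s) := by
    by_contra h
    have := sub_mem ((mem_maximalIdeal _).2 h) (add_mem hp hq)
    rw [add_sub_cancel_left] at this
    exact (mem_maximalIdeal _).1 this hs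
  refine ⟨x - y, hm' ▸ Ideal.subset_span (by simp), z, hm' ▸ Ideal.subset_span (by simp),
    Ideal.sq_span_le_of_isUnit (p := p) (q := r) (r := p + q + s) (s := t) (t := 2 * p + s)
      (w := t + w) hm' ?_ hu⟩
  rw [hf]; ring

/-- If the maximal ideal is generated by three elements and `f` is a quadric which does not lie in
its cube, then there are `a`, `b` in the maximal ideal with `𝔪 ^ 2 ⊆ (f) + (a, b) 𝔪`. -/
lemma exists_sq_maximalIdeal_le {f : R} (hgen : ∃ x : Fin 3 → R,
      maximalIdeal R = Ideal.span (Set.range x))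
    (hf : f ∈ maximalIdeal R ^ 2) (hf' : f ∉ maximalIdeal R ^ 3) :
    ∃ a ∈ maximalIdeal R, ∃ b ∈ maximalIdeal R,
      maximalIdeal R ^ 2 ≤ Ideal.span {f} ⊔ Ideal.span {a, b} * maximalIdeal R := by
  obtain ⟨g, hg⟩ := hgen
  obtain ⟨x, y, z, hm⟩ : ∃ x y z, maximalIdeal R = Ideal.span {x, y, z} := by
    refine ⟨g 0, g 1, g 2, hg.trans (congrArg _ ?_)⟩
    ext u
    simp [Fin.exists_fin_succ, eq_comm]
  have mx : x ∈ maximalIdeal R := hm ▸ Ideal.subset_span (by simp)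
  have my : y ∈ maximalIdeal R := hm ▸ Ideal.subset_span (by simp)
  have mz : z ∈ maximalIdeal R := hm ▸ Ideal.subset_span (by simp)
  obtain ⟨p, q, r, s, t, w, hfe⟩ : ∃ p q r s t w : R,
      f = p * x ^ 2 + q * y ^ 2 + r * z ^ 2 + s * (x * y) + t * (x * z) + w * (y * z) := by
    rw [pow_two] at hf
    refine Submodule.mul_induction_on hf ?_ ?_
    · intro g hg h hh
      rw [hm] at hg hh
      obtain ⟨a, b, c, rfl⟩ := Submodule.mem_span_triple.1 hg
      obtain ⟨a', b', c', rfl⟩ := Submodule.mem_span_triple.1 hh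
      exact ⟨a * a', b * b', c * c', a * b' + b * a', a * c' + c * a', b * c' + c * b', by
        simp only [smul_eq_mul]; ring⟩
    · rintro _ _ ⟨p, q, r, s, t, w, rfl⟩ ⟨p', q', r', s', t', w', rfl⟩
      exact ⟨p + p', q + q', r + r', s + s', t + t', w + w', by ring⟩
  by_cases hp : IsUnit p
  · refine ⟨y, my, z, mz, Ideal.sq_span_le_of_isUnit (x := y) (y := z) (z := x) (p := q) (q := r)
      (r := p) (s := w) (t := s) (w := t) (hm.trans (congrArg _ ?_)) (by rw [hfe]; ring) hp⟩
    grind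
  by_cases hq : IsUnit q
  · refine ⟨x, mx, z, mz, Ideal.sq_span_le_of_isUnit (x := x) (y := z) (z := y) (p := p) (q := r)
      (r := q) (s := t) (t := s) (w := w) (hm.trans (congrArg _ ?_)) (by rw [hfe]; ring) hq⟩
    grind
  by_cases hr : IsUnit r
  · exact ⟨x, mx, y, my, Ideal.sq_span_le_of_isUnit hm hfe hr⟩
  by_cases hs : IsUnit s
  · exact exists_sq_maximalIdeal_le_of_isUnit_mixed hm hfe hp hq hs
  by_cases ht : IsUnit t
  · refine exists_sq_maximalIdeal_le_of_isUnit_mixed (x := x) (y := z) (z := y) (p := p) (q := r)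
      (r := q) (s := t) (t := s) (w := w) (hm.trans (congrArg _ ?_)) (by rw [hfe]; ring) hp hr ht
    grind
  by_cases hw : IsUnit w
  · refine exists_sq_maximalIdeal_le_of_isUnit_mixed (x := y) (y := z) (z := x) (p := q) (q := r)
      (r := p) (s := w) (t := s) (w := t) (hm.trans (congrArg _ ?_)) (by rw [hfe]; ring) hq hr hw
    grind
  have key : ∀ c ∈ maximalIdeal R, ∀ u ∈ maximalIdeal R, ∀ v ∈ maximalIdeal R,
      c * (u * v) ∈ maximalIdeal R ^ 3 := by
    intro c hc u hu v hv
    rw [pow_succ', pow_two]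
    exact Ideal.mul_mem_mul hc (Ideal.mul_mem_mul hu hv)
  refine absurd ?_ hf'
  rw [hfe, pow_two, pow_two, pow_two]
  exact add_mem (add_mem (add_mem (add_mem (add_mem (key _ hp _ mx _ mx) (key _ hq _ my _ my))
    (key _ hr _ mz _ mz)) (key _ hs _ mx _ my)) (key _ ht _ mx _ mz)) (key _ hw _ my _ mz)

lemma sq_maximalIdeal_le_span_add_mul [IsNoetherianRing R] {a b s : R}
    (h : maximalIdeal R ^ 2 ≤ Ideal.span {a, b} * maximalIdeal R)
    (hs : s ∈ maximalIdeal R ^ 2) :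
    maximalIdeal R ^ 2 ≤ Ideal.span {a + s, b} * maximalIdeal R := by
  refine Submodule.le_of_le_smul_of_le_jacobson_bot (I := maximalIdeal R)
    (IsNoetherian.noetherian _) (maximalIdeal_le_jacobson _) (h.trans ?_)
  have hab : Ideal.span {a, b} ≤ Ideal.span {a + s, b} ⊔ maximalIdeal R ^ 2 := by
    rw [Ideal.span_le]
    rintro g (rfl | rfl)
    · have := sub_mem (Ideal.mem_sup_left (T := maximalIdeal R ^ 2)
        (Ideal.subset_span (by simp : g + s ∈ ({g + s, b} : Set R)))) (Ideal.mem_sup_right hs)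
      rwa [add_sub_cancel_right] at this
    · exact Ideal.mem_sup_left (Ideal.subset_span (by simp))
  calc Ideal.span {a, b} * maximalIdeal R
      ≤ (Ideal.span {a + s, b} ⊔ maximalIdeal R ^ 2) * maximalIdeal R := Ideal.mul_mono_left hab
    _ = _ := by rw [Ideal.sup_mul, smul_eq_mul, mul_comm (maximalIdeal R ^ 2)]

end Quadric

open Pointwise in
lemma length_quotSMulTop_ne_top {A M : Type*} [CommRing A] [IsNoetherianRing A] [IsLocalRing A]
    [AddCommGroup M] [Module A M] [Module.Finite A M] (hdim : ringKrullDim A ≤ 1) {x : A}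
    (hx : IsSMulRegular M x) (hxm : x ∈ maximalIdeal A) :
    Module.length A (M ⧸ x • (⊤ : Submodule A M)) ≠ ⊤ := by
  have h1 := Module.supportDim_quotSMulTop_succ_eq_supportDim hx hxm
  have h2 := h1.le.trans ((Module.supportDim_le_ringKrullDim A M).trans hdim)
  change Module.length A (QuotSMulTop x M) ≠ ⊤
  rw [Module.supportDim_eq_ringKrullDim_quotient_annihilator] at h2
  set I := Module.annihilator A (QuotSMulTop x M)
  have h0 : ringKrullDim (A ⧸ I) ≤ 0 := by
    generalize ringKrullDim (A ⧸ I) = d at h2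
    induction d with
    | bot => simp
    | coe d =>
      induction d with
      | top => exact absurd h2 (by decide)
      | coe d => norm_cast at h2 ⊢; omega
  have : Ring.KrullDimLE 0 (A ⧸ I) := (Ring.krullDimLE_iff).2 (by simpa using h0)
  have : IsArtinianRing (A ⧸ I) := isArtinianRing_iff_krullDimLE_zero.2 this
  let _ : Module (A ⧸ I) (QuotSMulTop x M) := Module.quotientAnnihilator
  have hfin : Module.Finite (A ⧸ I) (QuotSMulTop x M) :=
    Module.Finite.of_restrictScalars_finite A _ _
  have : IsArtinian A (QuotSMulTop x M) :=
    isArtinian_of_surjective_algebraMap (R := A ⧸ I) Ideal.Quotient.mk_surjective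
  exact Module.length_ne_top

section Depth

open CategoryTheory Abelian Limits RingTheory.Sequence Pointwise

universe u

variable {R : Type u} [CommRing R]

lemma subsingleton_ext_quotSMulTop {M N : ModuleCat.{u} R} {x : R} (hx : IsSMulRegular M x)
    {n : ℕ} (h : ∀ i < n + 1, Subsingleton (Ext N M i)) (i : ℕ) (hi : i < n) :
    Subsingleton (Ext N (ModuleCat.of R (QuotSMulTop x M)) i) := by
  have zero1 := AddCommGrpCat.isZero_of_iff_subsingleton.mpr (h i (by omega))
  have zero2 := AddCommGrpCat.isZero_of_iff_subsingleton.mpr (h (i + 1) (by omega))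
  exact AddCommGrpCat.subsingleton_of_isZero <| ShortComplex.Exact.isZero_of_both_zeros
    ((Ext.covariant_sequence_exact₃' N hx.smulShortComplex_shortExact) i (i + 1) rfl)
    (zero1.eq_zero_of_src _) (zero2.eq_zero_of_tgt _)

variable [IsLocalRing R]

lemma maximalIdeal_smul_top_lt_top (M : Type*) [AddCommGroup M] [Module R M] [Module.Finite R M]
    [Nontrivial M] : maximalIdeal R • (⊤ : Submodule R M) < ⊤ :=
  (Submodule.top_ne_ideal_smul_of_le_jacobson_annihilator
    (maximalIdeal_le_jacobson _)).symm.lt_top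

variable [IsNoetherianRing R]

lemma exists_isRegular_append_singleton_of_subsingleton_ext {N : ModuleCat.{u} R}
    [Module.Finite R N] (hN : Module.support R N = PrimeSpectrum.zeroLocus (maximalIdeal R))
    (rs : List R) (M : ModuleCat.{u} R) [Module.Finite R M] (hreg : IsRegular M rs)
    (h : ∀ i < rs.length + 1, Subsingleton (Ext N M i)) :
    ∃ r ∈ maximalIdeal R, IsRegular M (rs ++ [r]) := by
  induction rs generalizing M with
  | nil =>
    have := hreg.nontrivial
    obtain ⟨l, hl, hmem, hl'⟩ := ModuleCat.exists_isRegular_of_exists_subsingleton_ext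
      (maximalIdeal R) 1 M (maximalIdeal_smul_top_lt_top M) N hN h
    obtain ⟨r, rfl⟩ := List.length_eq_one_iff.1 hl
    exact ⟨r, hmem r (by simp), hl'⟩
  | cons a l ih =>
    rw [isRegular_cons_iff] at hreg
    obtain ⟨r, hr, hl⟩ := ih (ModuleCat.of R (QuotSMulTop a M)) hreg.2
      (subsingleton_ext_quotSMulTop hreg.1 h)
    exact ⟨r, hr, (isRegular_cons_iff _ _ _).2 ⟨hreg.1, hl⟩⟩

/-- A regular sequence shorter than another regular sequence in the maximal ideal can be
extended. -/
lemma exists_isRegular_append_singleton {M : Type u} [AddCommGroup M] [Module R M]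
    [Module.Finite R M] {rs rs' : List R} (hreg : IsRegular M rs) (hreg' : IsRegular M rs')
    (hmem : ∀ r ∈ rs', r ∈ maximalIdeal R) (hlt : rs.length < rs'.length) :
    ∃ r ∈ maximalIdeal R, IsRegular M (rs ++ [r]) := by
  have := hreg.nontrivial
  have hN : Module.support R (ModuleCat.of R (R ⧸ maximalIdeal R)) =
      PrimeSpectrum.zeroLocus (maximalIdeal R) := by
    rw [Module.support_eq_zeroLocus, Ideal.annihilator_quotient]
  exact exists_isRegular_append_singleton_of_subsingleton_ext hN rs (ModuleCat.of R M) hreg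
    fun i hi => ModuleCat.subsingleton_ext_of_exists_isRegular (maximalIdeal R) _ hN.subset
      (ModuleCat.of R M) (maximalIdeal_smul_top_lt_top M) rs' hmem hreg' i (by omega)

end Depth

section Assembly

open RingTheory.Sequence

lemma exists_isSMulRegular_of_one_le_seqDepth {R M : Type*} [CommRing R] [AddCommGroup M]
    [Module R M] {I : Ideal R} (h : seqDepth R M I = 1) : ∃ r ∈ I, IsSMulRegular M r := by
  by_contra! hI
  refine absurd h (ne_of_lt (lt_of_le_of_lt (sSup_le ?_) zero_lt_one))
  rintro _ ⟨rs, rfl, hmem, hreg⟩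
  cases rs with
  | nil => simp
  | cons r rs => exact absurd ((isRegular_cons_iff _ _ _).1 hreg).1 (hI r (hmem r (by simp)))

lemma seqDepth_self_eq_one {R : Type*} [CommRing R] [IsNoetherianRing R] [IsLocalRing R]
    (hdim : ringKrullDim R = 1) {r : R} (hr : r ∈ maximalIdeal R) (hreg : IsSMulRegular R r) :
    seqDepth R R (maximalIdeal R) = 1 := by
  refine le_antisymm (sSup_le ?_) (le_sSup ⟨[r], by simp, by simpa using hr, ?_⟩)
  · rintro _ ⟨rs, rfl, hmem, hrs⟩
    have h := ringKrullDim_add_length_eq_ringKrullDim_of_isRegular rs hrs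
    have : Nontrivial (R ⧸ Ideal.ofList rs) := Ideal.Quotient.nontrivial_iff.2 fun htop =>
      hrs.top_ne_smul (by rw [htop, Submodule.top_smul])
    rw [hdim] at h
    have h0 : (0 : WithBot ℕ∞) + rs.length ≤ 1 :=
      h ▸ add_le_add_left ringKrullDim_nonneg_of_nontrivial _
    rw [zero_add] at h0
    exact_mod_cast h0
  · rw [isRegular_iff_isWeaklyRegular_of_subset_maximalIdeal (by simpa using hr),
      isWeaklyRegular_singleton_iff]
    exact hreg

lemma hilbertFn_le_succ {A M : Type*} [CommRing A] [IsNoetherianRing A] [IsLocalRing A]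
    [AddCommGroup M] [Module A M] [Module.Finite A M] (hdim : ringKrullDim A ≤ 1) {a b : A}
    (ha : a ∈ maximalIdeal A) (hb : b ∈ maximalIdeal A)
    (hab : maximalIdeal A ^ 2 ≤ Ideal.span {a, b} * maximalIdeal A)
    (hdepth : seqDepth A M (maximalIdeal A) = 1) (n : ℕ) :
    hilbertFn A M (maximalIdeal A) n ≤ hilbertFn A M (maximalIdeal A) (n + 1) := by
  obtain ⟨r, hr, hreg⟩ := exists_isSMulRegular_of_one_le_seqDepth hdepth
  have hcompl := biUnion_associatedPrimes_eq_compl_regular A M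
  have hass (x : A) : IsSMulRegular M x ↔ ∀ P ∈ associatedPrimes A M, x ∉ P := by
    have := Set.ext_iff.1 hcompl x
    simp only [Set.mem_iUnion, SetLike.mem_coe, Set.mem_compl_iff, Set.mem_ofPred_eq] at this
    rw [← not_iff_not, ← this]
    push Not
    simp
  obtain ⟨j, hj, haj⟩ := exists_add_pow_notMem hr (associatedPrimes.finite A M)
    (fun P hP => IsAssociatedPrime.isPrime hP) ((hass r).1 hreg) a
  have hrj : r ^ j ∈ maximalIdeal A ^ 2 := Ideal.pow_le_pow_right hj (Ideal.pow_mem_pow hr j)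
  have hmem : a + r ^ j ∈ maximalIdeal A := add_mem ha (Ideal.pow_le_self two_ne_zero hrj)
  have hx := (hass _).2 haj
  rw [hilbertFn, hilbertFn, moduleLength, moduleLength, ← Module.coe_length, ← Module.coe_length,
    WithBot.coe_le_coe]
  exact Module.length_pow_smul_quotient_le_succ hmem hb (sq_maximalIdeal_le_span_add_mul hab hrj)
    hx (length_quotSMulTop_ne_top hdim hx hmem) n

end Assembly

/-- Let `(Q,𝔫)` be a three-dimensional regular local ring and `f₁, f₂ ∈ 𝔫²` a `Q`-regular
sequence with `f₁ ∈ 𝔫² \ 𝔫³`.  Then `A = Q/(f₁,f₂)` is a one-dimensional Cohen–Macaulay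
local ring, and the Hilbert function of every maximal Cohen–Macaulay `A`-module
is non-decreasing. -/
theorem hilbert_monotone_of_codim_two_ci.{u}
    (Q : Type u) [CommRing Q] [IsNoetherianRing Q] [IsLocalRing Q]
    (hdimQ : ringKrullDim Q = 3)
    (hregQ : ∃ x : Fin 3 → Q, maximalIdeal Q = Ideal.span (Set.range x))
    (f₁ f₂ : Q)
    (hf₁ : f₁ ∈ (maximalIdeal Q) ^ 2) (hf₂ : f₂ ∈ (maximalIdeal Q) ^ 2)
    (hreg : RingTheory.Sequence.IsRegular Q [f₁, f₂])
    (hf₁' : f₁ ∉ (maximalIdeal Q) ^ 3) :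
    ∃ _ : IsLocalRing (Q ⧸ Ideal.span {f₁, f₂}),
      ringKrullDim (Q ⧸ Ideal.span {f₁, f₂}) = 1 ∧
      seqDepth (Q ⧸ Ideal.span {f₁, f₂}) (Q ⧸ Ideal.span {f₁, f₂})
        (maximalIdeal (Q ⧸ Ideal.span {f₁, f₂})) = 1 ∧
      ∀ (M : Type u) [AddCommGroup M] [Module (Q ⧸ Ideal.span {f₁, f₂}) M]
        [Module.Finite (Q ⧸ Ideal.span {f₁, f₂}) M], Nontrivial M →
        seqDepth (Q ⧸ Ideal.span {f₁, f₂}) M (maximalIdeal (Q ⧸ Ideal.span {f₁, f₂})) = 1 →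
        ∀ n : ℕ, hilbertFn (Q ⧸ Ideal.span {f₁, f₂}) M (maximalIdeal (Q ⧸ Ideal.span {f₁, f₂})) n ≤
          hilbertFn (Q ⧸ Ideal.span {f₁, f₂}) M (maximalIdeal (Q ⧸ Ideal.span {f₁, f₂})) (n + 1) := by

  have hset : Ideal.span {f₁, f₂} = Ideal.ofList [f₁, f₂] := by
    rw [Ideal.ofList_cons, Ideal.ofList_singleton, Ideal.span_insert]
  have hmn : maximalIdeal Q ^ 2 ≤ maximalIdeal Q := Ideal.pow_le_self two_ne_zero
  set I := Ideal.span {f₁, f₂} with hI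
  have hIm : I ≤ maximalIdeal Q := by
    rw [hI, Ideal.span_le]
    rintro _ (rfl | rfl)
    exacts [hmn hf₁, hmn hf₂]
  have : Nontrivial (Q ⧸ I) := Ideal.Quotient.nontrivial_iff.2 fun h =>
    (maximalIdeal.isMaximal Q).ne_top (top_le_iff.1 (h ▸ hIm))
  have hsurj : Function.Surjective (Ideal.Quotient.mk I) := Ideal.Quotient.mk_surjective
  have hloc : IsLocalRing (Q ⧸ I) := .of_surjective' _ hsurj
  have hmap := map_maximalIdeal_of_surjective hsurj
  have hdim : ringKrullDim (Q ⧸ I) = 1 := by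
    have h := ringKrullDim_add_length_eq_ringKrullDim_of_isRegular [f₁, f₂] hreg
    rw [← hset, hdimQ] at h
    generalize ringKrullDim (Q ⧸ I) = d at h ⊢
    induction d with
    | bot => exact absurd h (by simp)
    | coe d =>
      induction d with
      | top => exact absurd h (by simp; decide)
      | coe d =>
        have h3 : ((d + 2 : ℕ) : WithBot ℕ∞) = (3 : ℕ) := by simpa using h
        obtain rfl : d = 1 := by have := Nat.cast_injective h3; omega
        rfl
  obtain ⟨r, hr, hregr⟩ : ∃ r ∈ maximalIdeal (Q ⧸ I), IsSMulRegular (Q ⧸ I) r := by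
    obtain ⟨x, hx⟩ := hregQ
    obtain ⟨-, rs, hlen, hmem, hrs⟩ := isDomain_and_exists_isWeaklyRegular 3 Q
      (by rw [hdimQ]; rfl) x hx
    obtain ⟨r, hr, hreg'⟩ := exists_isRegular_append_singleton hreg
      ((isRegular_iff_isWeaklyRegular_of_subset_maximalIdeal hmem).2 hrs) hmem (by simp [hlen])
    refine ⟨Ideal.Quotient.mk I r, hmap ▸ Ideal.mem_map_of_mem _ hr, ?_⟩
    have h := ((RingTheory.Sequence.isWeaklyRegular_append_iff Q _ _).1 hreg'.1).2
    rw [RingTheory.Sequence.isWeaklyRegular_singleton_iff] at h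
    have hIe : Ideal.ofList [f₁, f₂] • (⊤ : Submodule Q Q) = I := by
      rw [hset, smul_eq_mul, Ideal.mul_top]
    exact ((Submodule.quotEquivOfEq _ _ hIe).isSMulRegular_congr r).1 h
  obtain ⟨a, ha, b, hb, hab⟩ := exists_sq_maximalIdeal_le hregQ hf₁ hf₁'
  have hab' : maximalIdeal (Q ⧸ I) ^ 2 ≤
      Ideal.span {Ideal.Quotient.mk I a, Ideal.Quotient.mk I b} * maximalIdeal (Q ⧸ I) := by
    have h := Ideal.map_mono (f := Ideal.Quotient.mk I) hab
    have hf0 : Ideal.Quotient.mk I f₁ = 0 :=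
      Ideal.Quotient.eq_zero_iff_mem.2 (Ideal.subset_span (by simp))
    rwa [Ideal.map_sup, Ideal.map_mul, Ideal.map_pow, Ideal.map_span, Ideal.map_span, hmap,
      Set.image_singleton, Set.image_pair, hf0, Ideal.span_singleton_zero, bot_sup_eq] at h
  refine ⟨hloc, hdim, seqDepth_self_eq_one hdim hr hregr, ?_⟩
  intro M _ _ _ _ hM n
  exact hilbertFn_le_succ hdim.le (hmap ▸ Ideal.mem_map_of_mem _ ha)
    (hmap ▸ Ideal.mem_map_of_mem _ hb) hab' hM n
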